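/- Let σ₁ be the two-qutrit vector with amplitudes σ₁(y) = (1/3)·ω^{y₀ + y₁ + y₀y₁} for all y ∈ 𝔽₃² (exponent mod 3), let σ₂ = |2⟩⊗|2⟩, and let σ₃ be the entrywise complex conjugate of σ₁ (i.e. σ₃(y) = (1/3)·ω^{2(y₀ + y₁ + y₀y₁)}). Then |ℕ⟩^{⊗2} = −(ω/2)σ₁ + σ₂ − (ω²/2)σ₃. All three σⱼ are canonical 2-qutrit stabilizer states, so χ(|ℕ⟩^{⊗2}) ≤ 3. -/

import Mathlib

open Complex
open scoped BigOperators

noncomputable section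

/-- An `m`-qutrit state is a vector of amplitudes indexed by `Fin m → ZMod 3`. -/
abbrev QS (m : ℕ) := (Fin m → ZMod 3) → ℂ

/-- The primitive cube root of unity `ω = exp(2πi/3)`. -/
def ω : ℂ := Complex.exp (2 * Real.pi * Complex.I / 3)

/-- `ω` raised to an exponent in `ZMod 3`. -/
def ωp (a : ZMod 3) : ℂ := ω ^ a.val

/-- A polynomial `Q : 𝔽₃^k → 𝔽₃` of degree at most 2. -/
def IsDeg2 {k : ℕ} (Q : (Fin k → ZMod 3) → ZMod 3) : Prop :=
  ∃ (A : Fin k → Fin k → ZMod 3) (b : Fin k → ZMod 3) (c : ZMod 3),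
    ∀ y, Q y = (∑ i, ∑ j, A i j * y i * y j) + (∑ i, b i * y i) + c

/-- `σ` is a canonical `m`-qutrit stabilizer state:
`σ = 3^{-k/2} ∑_{y ∈ 𝔽₃^k} ω^{Q(y)} |x₀ + W y⟩` with `W` injective linear and `deg Q ≤ 2`. -/
def IsStab {m : ℕ} (σ : QS m) : Prop :=
  ∃ k : ℕ, k ≤ m ∧
    ∃ (x₀ : Fin m → ZMod 3)
      (W : (Fin k → ZMod 3) →ₗ[ZMod 3] (Fin m → ZMod 3))
      (Q : (Fin k → ZMod 3) → ZMod 3),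
      Function.Injective W ∧ IsDeg2 Q ∧
      σ = fun x => ((Real.sqrt (3 ^ k) : ℝ) : ℂ)⁻¹ *
        ∑ y : Fin k → ZMod 3, if x = x₀ + W y then ωp (Q y) else 0

/-- The stabilizer rank: the least `r` such that `ψ` is a ℂ-linear combination of `r`
canonical stabilizer states. -/
def stabRank {m : ℕ} (ψ : QS m) : ℕ :=
  sInf {r : ℕ | ∃ (c : Fin r → ℂ) (σ : Fin r → QS m),
    (∀ i, IsStab (σ i)) ∧ ψ = ∑ i, c i • σ i}

/-- The `m`-fold tensor power of a single-qutrit state. -/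
def tpow (ψ : ZMod 3 → ℂ) (m : ℕ) : QS m := fun x => ∏ i, ψ (x i)

/-- The Norrell state `|ℕ⟩ = (|0⟩ + |1⟩ - 2|2⟩)/√6`. -/
def Nor : ZMod 3 → ℂ := fun j =>
  ((if j = 0 then 1 else 0) + (if j = 1 then 1 else 0) - 2 * (if j = 2 then 1 else 0))
    / (Real.sqrt 6 : ℂ)

/-- `σ₁(y) = (1/3)·ω^{y₀ + y₁ + y₀y₁}`. -/
def σN1 : QS 2 := fun y => (1 / 3 : ℂ) * ωp (y 0 + y 1 + y 0 * y 1)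

/-- `σ₂ = |2⟩ ⊗ |2⟩`. -/
def σN2 : QS 2 := fun y => if y 0 = 2 ∧ y 1 = 2 then 1 else 0

/-- `σ₃(y) = (1/3)·ω^{2(y₀ + y₁ + y₀y₁)}`, the entrywise conjugate of `σ₁`. -/
def σN3 : QS 2 := fun y => (1 / 3 : ℂ) * ωp (2 * (y 0 + y 1 + y 0 * y 1))

theorem isPrimitiveRoot_ω : IsPrimitiveRoot ω 3 := by
  simpa [ω] using Complex.isPrimitiveRoot_exp 3 (by norm_num)

theorem ω_pow_three : ω ^ 3 = 1 := isPrimitiveRoot_ω.pow_eq_one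

theorem one_add_ω_add_ω_sq : 1 + ω + ω ^ 2 = 0 := by
  simpa [Finset.sum_range_succ] using isPrimitiveRoot_ω.geom_sum_eq_zero (by norm_num)

theorem conj_ω : starRingEnd ℂ ω = ω ^ 2 := by
  rw [← Complex.inv_eq_conj (isPrimitiveRoot_ω.norm'_eq_one (by norm_num))]
  exact inv_eq_of_mul_eq_one_right (by rw [← ω_pow_three]; ring)

theorem ωp_add (a b : ZMod 3) : ωp (a + b) = ωp a * ωp b := by
  rw [ωp, ωp, ωp, ZMod.val_add, ← pow_add, ← pow_eq_pow_mod _ ω_pow_three]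

theorem ωp_one : ωp 1 = ω := pow_one ω

theorem ωp_two : ωp 2 = ω ^ 2 := rfl

theorem conj_ωp (a : ZMod 3) : starRingEnd ℂ (ωp a) = ωp (2 * a) := by
  rw [two_mul, ωp_add, ωp, map_pow, conj_ω, ← pow_mul, two_mul, pow_add]

theorem ωp_add_ωp_two_mul (n : ZMod 3) :
    ωp n + ωp (2 * n) = if n = 0 then 2 else -1 := by
  rw [two_mul, ωp_add]
  have h := one_add_ω_add_ω_sq
  have h3 := ω_pow_three
  obtain rfl | rfl | rfl : n = 0 ∨ n = 1 ∨ n = 2 := by revert n; decide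
  · norm_num [ωp]
  · rw [ωp_one, if_neg (by decide)]
    linear_combination h
  · rw [ωp_two, if_neg (by decide)]
    linear_combination h + ω * h3

/-- A uniform superposition with quadratic phases is a stabilizer state. -/
theorem isStab_phase {m : ℕ} {Q : (Fin m → ZMod 3) → ZMod 3} (hQ : IsDeg2 Q) :
    IsStab fun x => ((Real.sqrt (3 ^ m) : ℝ) : ℂ)⁻¹ * ωp (Q x) :=
  ⟨m, le_rfl, 0, LinearMap.id, Q, Function.injective_id, hQ, by simp⟩

/-- Computational basis states are stabilizer states. -/
theorem isStab_basis {m : ℕ} (x₀ : Fin m → ZMod 3) :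
    IsStab fun x => if x = x₀ then 1 else 0 :=
  ⟨0, Nat.zero_le m, x₀, 0, 0, Function.injective_of_subsingleton _,
    ⟨0, 0, 0, by simp⟩, by simp [ωp]⟩

theorem isDeg2_mul_phase (c : ZMod 3) :
    IsDeg2 fun y : Fin 2 → ZMod 3 => c * (y 0 + y 1 + y 0 * y 1) :=
  ⟨fun i j => if i = 0 ∧ j = 1 then c else 0, fun _ => c, 0, fun y => by
    simp [Fin.sum_univ_two]; ring⟩

theorem inv_sqrt_three_sq : ((Real.sqrt (3 ^ 2) : ℝ) : ℂ)⁻¹ = 1 / 3 := by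
  rw [Real.sqrt_sq (by norm_num)]; norm_num

theorem isStab_σN1 : IsStab σN1 := by
  unfold σN1
  simpa only [one_mul, inv_sqrt_three_sq] using isStab_phase (isDeg2_mul_phase 1)

theorem isStab_σN2 : IsStab σN2 := by
  convert isStab_basis (m := 2) (fun _ => 2) using 1
  funext y
  simp [σN2, funext_iff, Fin.forall_fin_two]

theorem isStab_σN3 : IsStab σN3 := by
  unfold σN3
  simpa only [inv_sqrt_three_sq] using isStab_phase (isDeg2_mul_phase 2)

theorem Nor_apply (j : ZMod 3) :
    Nor j = (if j = 2 then -2 else 1) / (Real.sqrt 6 : ℂ) := by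
  obtain rfl | rfl | rfl : j = 0 ∨ j = 1 ∨ j = 2 := by revert j; decide
  all_goals simp [Nor, show (0 : ZMod 3) ≠ 2 by decide, show (1 : ZMod 3) ≠ 2 by decide,
    show (2 : ZMod 3) ≠ 0 by decide, show (2 : ZMod 3) ≠ 1 by decide]

theorem tpow_Nor_two :
    tpow Nor 2 = (-(ω / 2)) • σN1 + σN2 + (-(ω ^ 2 / 2)) • σN3 := by
  funext y
  have h := ωp_add_ωp_two_mul (1 + (y 0 + y 1 + y 0 * y 1))
  rw [mul_add, ωp_add 1, mul_one, ωp_add 2, ωp_one, ωp_two] at h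
  have h6 : (Real.sqrt 6 : ℂ) ^ 2 = 6 := by
    rw [← Complex.ofReal_pow, Real.sq_sqrt (by norm_num)]; norm_num
  have hzero : 1 + (y 0 + y 1 + y 0 * y 1) = 0 ↔ y 0 = 2 ∨ y 1 = 2 := by
    generalize y 0 = a
    generalize y 1 = b
    revert a b
    decide
  rw [if_congr hzero rfl rfl] at h
  simp only [tpow, Fin.prod_univ_two, Nor_apply, div_mul_div_comm, ← sq, h6, σN1, σN2, σN3,
    Pi.add_apply, Pi.smul_apply, smul_eq_mul]
  by_cases h0 : y 0 = 2 <;> by_cases h1 : y 1 = 2 <;>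
    simp only [h0, h1, if_true, if_false, or_true, or_false, and_true, and_false] at h ⊢ <;>
    linear_combination (1 / 6) * h

theorem stabRank_le {m r : ℕ} {ψ : QS m} (c : Fin r → ℂ) (σ : Fin r → QS m)
    (hσ : ∀ i, IsStab (σ i)) (h : ψ = ∑ i, c i • σ i) : stabRank ψ ≤ r :=
  Nat.sInf_le ⟨c, σ, hσ, h⟩

/-- `σ₃` is the entrywise complex conjugate of `σ₁`,
`|ℕ⟩^{⊗2} = -(ω/2)σ₁ + σ₂ - (ω²/2)σ₃`; all three are canonical 2-qutrit stabilizer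
states, so `χ(|ℕ⟩^{⊗2}) ≤ 3`. -/
theorem norrell_m2_decomposition :
    (∀ y, σN3 y = starRingEnd ℂ (σN1 y)) ∧
    tpow Nor 2 = (-(ω / 2)) • σN1 + σN2 + (-(ω ^ 2 / 2)) • σN3 ∧
    IsStab σN1 ∧ IsStab σN2 ∧ IsStab σN3 ∧
    stabRank (tpow Nor 2) ≤ 3 := by
  refine ⟨fun y => ?_, tpow_Nor_two, isStab_σN1, isStab_σN2, isStab_σN3, ?_⟩
  · rw [σN1, σN3, map_mul, conj_ωp, map_div₀, map_one, map_ofNat]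
  · refine stabRank_le ![-(ω / 2), 1, -(ω ^ 2 / 2)] ![σN1, σN2, σN3] ?_ ?_
    · simp [Fin.forall_fin_succ, isStab_σN1, isStab_σN2, isStab_σN3]
    · simp [Fin.sum_univ_three, tpow_Nor_two]
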